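/- arXiv:2405.11880 — 2 statements merged into one kernel-verified Lean document; each statement's English description precedes it below -/
import Mathlib

section
/- Let N be a finite set and let v_or : Finset N → ℝ be any function. Define, for each nonempty S ⊆ N, the OR interaction I_or(S) := −Σ_{L ⊆ S} (−1)^{|S|−|L|} · v_or(N \ L), and set I_or(∅) := v_or(∅). Then for every T ⊆ N, v_or(T) = I_or(∅) + Σ_{S ⊆ N, S ∩ T ≠ ∅} I_or(S); equivalently, Σ_{∅ ≠ S ⊆ N, S ∩ T ≠ ∅} I_or(S) = v_or(T) − v_or(∅). -/
open Finset

/-- Möbius inversion on the Boolean lattice: summing the signed subset sums of `f` over all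
subsets of `A` recovers `f A`. -/
theorem sum_powerset_sum_powerset_neg_one_pow {α R : Type*} [DecidableEq α] [CommRing R]
    (f : Finset α → R) (A : Finset α) :
    ∑ S ∈ A.powerset, ∑ L ∈ S.powerset, (-1 : R) ^ (S.card - L.card) * f L = f A := by
  induction A using Finset.induction_on generalizing f with
  | empty => simp
  | insert a A ha ih =>
    rw [Finset.sum_powerset_insert ha, ← ih (fun L => f (insert a L)), ← Finset.sum_add_distrib]
    refine Finset.sum_congr rfl fun S hS => ?_
    have haS : a ∉ S := fun h => ha (Finset.mem_powerset.1 hS h)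
    rw [Finset.sum_powerset_insert haS, ← add_assoc, ← Finset.sum_add_distrib,
      ← Finset.sum_add_distrib]
    refine Finset.sum_congr rfl fun L hL => ?_
    have hLS := Finset.mem_powerset.1 hL
    have haL : a ∉ L := fun h => haS (hLS h)
    rw [Finset.card_insert_of_notMem haS, Finset.card_insert_of_notMem haL,
      Nat.add_sub_add_right, Nat.sub_add_comm (Finset.card_le_card hLS), pow_succ]
    ring

/-- For any `v_or : Finset N → ℝ` on a finite set `N`, defining the OR
interaction of a nonempty `S` as `I_or(S) = -∑_{L ⊆ S} (-1)^(|S|-|L|) v_or(N \ L)` and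
`I_or(∅) = v_or(∅)`, for every `T ⊆ N` we have
`v_or(T) = I_or(∅) + ∑_{∅ ≠ S ⊆ N, S ∩ T ≠ ∅} I_or(S)`. -/
theorem sum_or_interactions_eq {N : Type*} [Fintype N] [DecidableEq N]
    (v_or : Finset N → ℝ) (T : Finset N) :
    v_or T = v_or ∅ +
      ∑ S ∈ (Finset.univ : Finset N).powerset.filter
          (fun S => S ≠ ∅ ∧ (S ∩ T).Nonempty),
        (-(∑ L ∈ S.powerset, (-1 : ℝ) ^ (S.card - L.card) * v_or Lᶜ)) := by
  have hmeet : (Finset.univ : Finset N).powerset.filter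
      (fun S => S ≠ ∅ ∧ (S ∩ T).Nonempty) =
      (Finset.univ : Finset N).powerset \ Tᶜ.powerset := by
    ext S
    have hsub : S ⊆ Tᶜ ↔ ¬(S ∩ T).Nonempty := by
      rw [Finset.subset_compl_iff_disjoint_right, Finset.disjoint_iff_inter_eq_empty,
        Finset.not_nonempty_iff_eq_empty]
    simp only [Finset.mem_filter, Finset.mem_sdiff, Finset.mem_powerset, hsub, not_not]
    exact and_congr_right fun _ => and_iff_right_of_imp fun h => (h.mono inter_subset_left).ne_empty
  rw [hmeet, Finset.sum_neg_distrib, Finset.sum_sdiff_eq_sub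
      (Finset.powerset_mono.2 (Finset.subset_univ _)),
    sum_powerset_sum_powerset_neg_one_pow (fun L => v_or Lᶜ),
    sum_powerset_sum_powerset_neg_one_pow (fun L => v_or Lᶜ), Finset.compl_univ, compl_compl]
  ring
end

section
/- (Universal matching property.) Let N be a finite set and let v, v_and, v_or : Finset N → ℝ satisfy v(T) = v_and(T) + v_or(T) + v(∅) for every T ⊆ N. Define for each S ⊆ N the AND interaction I_and(S) := Σ_{L ⊆ S} (−1)^{|S|−|L|} v_and(L), and for each nonempty S ⊆ N the OR interaction I_or(S) := −Σ_{L ⊆ S} (−1)^{|S|−|L|} v_or(N \ L). Then for every T ⊆ N, v(T) = v(∅) + Σ_{∅ ≠ S ⊆ T} I_and(S) + Σ_{∅ ≠ S ⊆ N, S ∩ T ≠ ∅} I_or(S). -/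
open Finset

/-- Möbius inversion on the subsets of a finite set. -/
theorem Finset.sum_powerset_sum_powerset_neg_one_pow_mul {α R : Type*} [DecidableEq α]
    [CommRing R] (f : Finset α → R) (T : Finset α) :
    ∑ S ∈ T.powerset, ∑ L ∈ S.powerset, (-1 : R) ^ (S.card - L.card) * f L = f T := by
  induction T using Finset.induction_on generalizing f with
  | empty => simp
  | insert a T ha ih =>
    have insert_eq : ∀ S ∈ T.powerset,
        ∑ L ∈ (insert a S).powerset, (-1 : R) ^ ((insert a S).card - L.card) * f L =
          -∑ L ∈ S.powerset, (-1 : R) ^ (S.card - L.card) * f L +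
            ∑ L ∈ S.powerset, (-1 : R) ^ (S.card - L.card) * f (insert a L) := by
      intro S hS
      have haS : a ∉ S := fun h => ha (mem_powerset.mp hS h)
      rw [sum_powerset_insert haS, ← sum_neg_distrib]
      congr 1 <;> refine sum_congr rfl fun L hL => ?_
      · have hLS := card_le_card (mem_powerset.mp hL)
        rw [card_insert_of_notMem haS, Nat.succ_sub hLS, pow_succ]
        ring
      · have haL : a ∉ L := fun h => haS (mem_powerset.mp hL h)
        rw [card_insert_of_notMem haS, card_insert_of_notMem haL, Nat.add_sub_add_right]
    rw [sum_powerset_insert ha, sum_congr rfl insert_eq, sum_add_distrib, sum_neg_distrib,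
      ih fun L => f (insert a L)]
    ring

/-- **Universal matching property.** If `v(T) = v_and(T) + v_or(T) + v(∅)` for all
`T ⊆ N`, then with `I_and(S) = ∑_{L ⊆ S} (-1)^(|S|-|L|) v_and(L)` and, for nonempty `S`,
`I_or(S) = -∑_{L ⊆ S} (-1)^(|S|-|L|) v_or(N \ L)`, we have for every `T ⊆ N`:
`v(T) = v(∅) + ∑_{∅ ≠ S ⊆ T} I_and(S) + ∑_{∅ ≠ S ⊆ N, S ∩ T ≠ ∅} I_or(S)`. -/
theorem universal_matching {N : Type*} [Fintype N] [DecidableEq N]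
    (v v_and v_or : Finset N → ℝ)
    (h : ∀ T : Finset N, v T = v_and T + v_or T + v ∅) (T : Finset N) :
    v T = v ∅
      + ∑ S ∈ T.powerset.filter (fun S => S ≠ ∅),
          (∑ L ∈ S.powerset, (-1 : ℝ) ^ (S.card - L.card) * v_and L)
      + ∑ S ∈ (Finset.univ : Finset N).powerset.filter
            (fun S => S ≠ ∅ ∧ (S ∩ T).Nonempty),
          (-(∑ L ∈ S.powerset, (-1 : ℝ) ^ (S.card - L.card) * v_or Lᶜ)) := by
  have and_sum : ∑ S ∈ T.powerset.filter (fun S => S ≠ ∅),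
      (∑ L ∈ S.powerset, (-1 : ℝ) ^ (S.card - L.card) * v_and L) = v_and T - v_and ∅ := by
    have inversion := sum_powerset_sum_powerset_neg_one_pow_mul v_and T
    rw [← add_sum_erase _ _ (empty_mem_powerset T)] at inversion
    rw [filter_ne']
    simp only [powerset_empty, sum_singleton, card_empty, Nat.sub_self, pow_zero, one_mul]
      at inversion
    linarith
  have or_sum : ∑ S ∈ (Finset.univ : Finset N).powerset.filter
        (fun S => S ≠ ∅ ∧ (S ∩ T).Nonempty),
      (-(∑ L ∈ S.powerset, (-1 : ℝ) ^ (S.card - L.card) * v_or Lᶜ)) = v_or T - v_or ∅ := by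
    have meets : (univ : Finset N).powerset.filter (fun S => S ≠ ∅ ∧ (S ∩ T).Nonempty) =
        univ.powerset \ Tᶜ.powerset := by
      ext S
      simp only [mem_filter, mem_sdiff, mem_powerset, subset_univ, true_and,
        subset_compl_iff_disjoint_right, not_disjoint_iff_nonempty_inter, and_iff_right_iff_imp]
      rintro hS rfl
      simp at hS
    have hsub : Tᶜ.powerset ⊆ (univ : Finset N).powerset := powerset_mono.mpr (subset_univ _)
    rw [meets, sum_neg_distrib, sum_sdiff_eq_sub hsub,
      sum_powerset_sum_powerset_neg_one_pow_mul (fun L => v_or Lᶜ),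
      sum_powerset_sum_powerset_neg_one_pow_mul (fun L => v_or Lᶜ), compl_univ, compl_compl]
    ring
  rw [and_sum, or_sum]
  linarith [h T, h ∅]
end
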